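/- Continuity of the characteristic function: let Q_j, Q, T_j, T be almost self-dual ℤ_p-submodules of H. If Q_j ↗ Q and T_j ↗ T, then for every g ∈ GL(α+km, ℚ_p) one has χ_g(Q_j, T_j) ↗ χ_g(Q, T) as submodules of V⊕V. -/

import Mathlib

open scoped BigOperators

/-- The symplectic coordinate space `ℚ_p^n ⊕ ℚ_p^n`, written as pairs `(x⁺, x⁻)`. -/
abbrev SpV (p : ℕ) [Fact p.Prime] (n : ℕ) := (Fin n → ℚ_[p]) × (Fin n → ℚ_[p])

/-- The standard skew-symmetric bilinear form `B(x, y) = Σ_s (x_s⁺ y_s⁻ − x_s⁻ y_s⁺)`. -/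
noncomputable def Bform (p : ℕ) [Fact p.Prime] (n : ℕ) (x y : SpV p n) : ℚ_[p] :=
  ∑ s, (x.1 s * y.2 s - x.2 s * y.1 s)

/-- The form `B^⊖(u ⊕ v, u' ⊕ v') = B_V(u, u') − B_V(v, v')` on `V ⊕ V`. -/
noncomputable def Bminus (p : ℕ) [Fact p.Prime] (α : ℕ) (z w : SpV p α × SpV p α) : ℚ_[p] :=
  Bform p α z.1 w.1 - Bform p α z.2 w.2

/-- The dual module `P^⊥⊥ = {w : B(v,w) ∈ ℤ_p for all v ∈ P}` of a set `P` with respect to a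
bilinear form `B` (membership in `ℤ_p` expressed as `‖·‖ ≤ 1`). -/
def dualMod (p : ℕ) [Fact p.Prime] {X : Type*} (B : X → X → ℚ_[p]) (P : Set X) : Set X :=
  {w | ∀ v ∈ P, ‖B v w‖ ≤ 1}

/-- A set is *self-dual* with respect to `B` if it coincides with its dual module. -/
def IsSelfDual (p : ℕ) [Fact p.Prime] {X : Type*} (B : X → X → ℚ_[p]) (P : Set X) : Prop :=
  dualMod p B P = P

/-- A `ℤ_p`-submodule of a `ℚ_p`-vector space: a set containing `0`, closed under addition
and under multiplication by p-adic integers (scalars of norm at most 1). -/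
def IsZpSubmodule (p : ℕ) [Fact p.Prime] {X : Type*} [AddCommGroup X] [Module ℚ_[p] X]
    (P : Set X) : Prop :=
  (0 : X) ∈ P ∧ (∀ x ∈ P, ∀ y ∈ P, x + y ∈ P) ∧
    ∀ c : ℚ_[p], ‖c‖ ≤ 1 → ∀ x ∈ P, c • x ∈ P

/-- The index set `{1,…,α} ⊔ ({1,…,k} × {1,…,m})` for matrices in `GL(α + km, ℚ_p)`. -/
abbrev BigIx (α k m : ℕ) := Fin α ⊕ (Fin k × Fin m)

/-- Glue a vector `u ∈ ℚ_p^α` and a tuple `x = (x_1, …, x_k)` with `x_j ∈ ℚ_p^m` into a single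
vector indexed by `BigIx α k m`. -/
def glue {p α k m : ℕ} [Fact p.Prime] (u : Fin α → ℚ_[p]) (x : Fin k → Fin m → ℚ_[p]) :
    BigIx α k m → ℚ_[p] :=
  Sum.elim u fun js => x js.1 js.2

/-- The slice of a tuple `x = (x⁺, x⁻)` (with `x_j^± ∈ ℚ_p^m`) at coordinate `s`, as an
element of `H = ℚ_p^k ⊕ ℚ_p^k`. -/
def tupleSlice {p k m : ℕ} [Fact p.Prime]
    (xp xm : Fin k → Fin m → ℚ_[p]) (s : Fin m) : SpV p k :=
  (fun j => xp j s, fun j => xm j s)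

/-- **The characteristic function** `χ_g(Q, T)` of `g ∈ GL(α + km, ℚ_p)` (viewed as a matrix
`M` on the index set `BigIx α k m`): the set of all `(u⁺ ⊕ u⁻) ⊕ (v⁺ ⊕ v⁻) ∈ V ⊕ V` for which
there exist `x ∈ Q ⊗ ℤ_p^m` and `y ∈ T ⊗ ℤ_p^m` with `(v⁺, y⁺) = g (u⁺, x⁺)` and
`(u⁻, x⁻) = gᵗ (v⁻, y⁻)`. -/
def chiM (p α k m : ℕ) [Fact p.Prime]
    (M : Matrix (BigIx α k m) (BigIx α k m) ℚ_[p]) (Q T : Set (SpV p k)) :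
    Set (SpV p α × SpV p α) :=
  {uv | ∃ xp xm yp ym : Fin k → Fin m → ℚ_[p],
    (∀ s : Fin m, tupleSlice xp xm s ∈ Q) ∧
    (∀ s : Fin m, tupleSlice yp ym s ∈ T) ∧
    glue uv.2.1 yp = M.mulVec (glue uv.1.1 xp) ∧
    glue uv.1.2 xm = M.transpose.mulVec (glue uv.2.2 ym)}

/-- A set `P` is *almost self-dual* with respect to `B` if it contains a self-dual submodule
and `B(v, w) ∈ p^{-1} ℤ_p` (i.e. `‖B(v,w)‖ ≤ p`) for all `v, w ∈ P`. -/
def IsAlmostSelfDual (p : ℕ) [Fact p.Prime] {X : Type*}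
    (B : X → X → ℚ_[p]) (P : Set X) : Prop :=
  (∃ S : Set X, S ⊆ P ∧ IsSelfDual p B S) ∧ ∀ v ∈ P, ∀ w ∈ P, ‖B v w‖ ≤ (p : ℝ)

/-- The convergence `R_j ↗ R` of sets in a normed space: (i) every compact subset of `R` is
eventually contained in `R_j`; (ii) for every `ε > 0`, `R_j` is eventually contained in the
`ε`-neighborhood of `R`. -/
def ConvUp {X : Type*} [SeminormedAddCommGroup X] (Rs : ℕ → Set X) (R : Set X) : Prop :=
  (∀ S : Set X, S ⊆ R → IsCompact S → ∃ J : ℕ, ∀ j : ℕ, J ≤ j → S ⊆ Rs j) ∧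
  (∀ ε : ℝ, 0 < ε → ∃ J : ℕ, ∀ j : ℕ, J ≤ j → ∀ x ∈ Rs j, ∃ r ∈ R, ‖x - r‖ ≤ ε)

section ZpSubmodules

variable {p : ℕ} [Fact p.Prime]

/-- One step of the nonarchimedean Hahn–Banach extension: the correction of a functional `f`,
bounded by `1` on the part of `P` in the kernel of `g`, by a multiple of `g`. -/
lemma exists_norm_add_mul_le_one {X : Type*} [AddCommGroup X] [Module ℚ_[p] X] {P : Set X}
    (hP : IsZpSubmodule p P) (f g : X →ₗ[ℚ_[p]] ℚ_[p])
    (hf : ∀ x ∈ P, g x = 0 → ‖f x‖ ≤ 1) :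
    ∃ c : ℚ_[p], ∀ x ∈ P, ‖f x + c * g x‖ ≤ 1 := by
  by_cases hne : Nonempty {x : X // x ∈ P ∧ g x ≠ 0}
  swap
  · refine ⟨0, fun x hx => ?_⟩
    have : g x = 0 := by
      by_contra h
      exact hne ⟨⟨x, hx, h⟩⟩
    simpa using hf x hx this
  have key : (⋂ a : {x : X // x ∈ P ∧ g x ≠ 0},
      {c : ℚ_[p] | ‖f a.1 + c * g a.1‖ ≤ 1}).Nonempty := by
    have hcl (a : {x : X // x ∈ P ∧ g x ≠ 0}) :
        IsClosed {c : ℚ_[p] | ‖f a.1 + c * g a.1‖ ≤ 1} :=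
      isClosed_le (by fun_prop) continuous_const
    have hmono (a b : {x : X // x ∈ P ∧ g x ≠ 0}) (hab : ‖g b.1‖ ≤ ‖g a.1‖) (c : ℚ_[p])
        (hc : ‖f a.1 + c * g a.1‖ ≤ 1) : ‖f b.1 + c * g b.1‖ ≤ 1 := by
      have ha := a.2.2
      have ht : ‖g b.1 / g a.1‖ ≤ 1 := by
        rw [norm_div]
        exact div_le_one_of_le₀ hab (norm_nonneg _)
      have hd : ‖f (b.1 + (-(g b.1 / g a.1)) • a.1)‖ ≤ 1 := by
        refine hf _ (hP.2.1 _ b.2.1 _ (hP.2.2 _ (by rwa [norm_neg]) _ a.2.1)) ?_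
        simp only [map_add, map_smul, smul_eq_mul]
        field_simp
        ring
      have he : f b.1 + c * g b.1 = (g b.1 / g a.1) * (f a.1 + c * g a.1) +
          f (b.1 + (-(g b.1 / g a.1)) • a.1) := by
        simp only [map_add, map_smul, smul_eq_mul]
        field_simp
        ring
      rw [he]
      refine (Padic.nonarchimedean _ _).trans (max_le ?_ hd)
      rw [norm_mul]
      exact mul_le_one₀ ht (norm_nonneg _) hc
    refine IsCompact.nonempty_iInter_of_directed_nonempty_isCompact_isClosed _ ?_ ?_ ?_ hcl
    · intro a b
      rcases le_total ‖g b.1‖ ‖g a.1‖ with h | h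
      · exact ⟨a, fun c hc => hc, fun c hc => hmono a b h c hc⟩
      · exact ⟨b, fun c hc => hmono b a h c hc, fun c hc => hc⟩
    · intro a
      refine ⟨-(f a.1 / g a.1), ?_⟩
      have ha := a.2.2
      have : f a.1 + -(f a.1 / g a.1) * g a.1 = 0 := by
        field_simp
        ring
      change ‖_‖ ≤ 1
      rw [this, norm_zero]
      exact zero_le_one
    · intro a
      have ha := a.2.2
      refine ((isCompact_closedBall (0 : ℚ_[p]) 1).image
        (f := fun x => (x - f a.1) / g a.1) (by fun_prop)).of_isClosed_subset (hcl a) ?_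
      intro c hc
      refine ⟨f a.1 + c * g a.1, by simpa using hc, ?_⟩
      field_simp
      ring
  obtain ⟨c, hc⟩ := key
  refine ⟨c, fun x hx => ?_⟩
  by_cases h : g x = 0
  · simpa [h] using hf x hx h
  · exact Set.mem_iInter.1 hc ⟨x, hx, h⟩

/-- A `ℤ_p`-submodule of a finite-dimensional `ℚ_p`-space is separated from every point outside
it by a linear functional. -/
lemma exists_functional_of_notMem {X : Type*} [AddCommGroup X] [Module ℚ_[p] X]
    [FiniteDimensional ℚ_[p] X] {P : Set X} (hP : IsZpSubmodule p P) {w : X} (hw : w ∉ P) :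
    ∃ f : X →ₗ[ℚ_[p]] ℚ_[p], (∀ x ∈ P, ‖f x‖ ≤ 1) ∧ 1 < ‖f w‖ := by
  have hw0 : w ≠ 0 := fun h => hw (h ▸ hP.1)
  have hstart : ∃ W : Submodule ℚ_[p] X, w ∈ W ∧
      ∃ f : X →ₗ[ℚ_[p]] ℚ_[p], (∀ x ∈ P, x ∈ W → ‖f x‖ ≤ 1) ∧ 1 < ‖f w‖ := by
    refine ⟨ℚ_[p] ∙ w, Submodule.mem_span_singleton_self w, ?_⟩
    obtain ⟨f, hf, -⟩ := Submodule.exists_le_ker_of_notMem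
      (p := (⊥ : Submodule ℚ_[p] X)) (v := w) (by simpa using hw0)
    have hp1 : (1 : ℝ) < p := by exact_mod_cast (Fact.out : p.Prime).one_lt
    have hp0 : (0 : ℝ) < p := by linarith
    refine ⟨((p : ℚ_[p])⁻¹ * (f w)⁻¹) • f, ?_, ?_⟩
    · intro x hx hxw
      obtain ⟨t, rfl⟩ := Submodule.mem_span_singleton.1 hxw
      have ht : ‖t‖ < 1 := by
        by_contra! h
        have ht0 : t ≠ 0 := by
          rintro rfl
          simp at h
          linarith
        refine hw ?_
        have := hP.2.2 t⁻¹ (by rw [norm_inv]; exact inv_le_one_of_one_le₀ h) _ hx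
        rwa [smul_smul, inv_mul_cancel₀ ht0, one_smul] at this
      have ht' : ‖t‖ ≤ (p : ℝ)⁻¹ := by
        have := (Padic.norm_le_pow_iff_norm_lt_pow_add_one t (-1)).2 (by simpa using ht)
        simpa using this
      have : (((p : ℚ_[p])⁻¹ * (f w)⁻¹) • f) (t • w) = (p : ℚ_[p])⁻¹ * t := by
        simp only [LinearMap.smul_apply, map_smul, smul_eq_mul]
        field_simp
      rw [this, norm_mul, norm_inv, Padic.norm_p, inv_inv]
      calc (p : ℝ) * ‖t‖ ≤ p * (p : ℝ)⁻¹ := by gcongr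
        _ = 1 := mul_inv_cancel₀ hp0.ne'
    · have : (((p : ℚ_[p])⁻¹ * (f w)⁻¹) • f) w = (p : ℚ_[p])⁻¹ := by
        simp only [LinearMap.smul_apply, smul_eq_mul]
        field_simp
      rw [this, norm_inv, Padic.norm_p, inv_inv]
      exact hp1
  obtain ⟨W, ⟨hwW, f, hf, hfw⟩, hmax⟩ := exists_maximal_of_wellFoundedGT _ hstart
  by_cases htop : W = ⊤
  · subst htop
    exact ⟨f, fun x hx => hf x hx trivial, hfw⟩
  exfalso
  obtain ⟨v, hv⟩ : ∃ v, v ∉ W := by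
    by_contra! h
    exact htop (Submodule.eq_top_iff'.2 h)
  obtain ⟨g, hgv, hgW⟩ := Submodule.exists_le_ker_of_notMem hv
  have hP' : IsZpSubmodule p (P ∩ (W ⊔ ℚ_[p] ∙ v : Submodule ℚ_[p] X)) :=
    ⟨⟨hP.1, zero_mem _⟩, fun x hx y hy => ⟨hP.2.1 x hx.1 y hy.1, add_mem hx.2 hy.2⟩,
      fun c hc x hx => ⟨hP.2.2 c hc x hx.1, Submodule.smul_mem _ c hx.2⟩⟩
  obtain ⟨c, hc⟩ := exists_norm_add_mul_le_one hP' f g (by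
    rintro x ⟨hxP, hx⟩ hgx
    obtain ⟨y, hy, z, hz, rfl⟩ := Submodule.mem_sup.1 hx
    obtain ⟨t, rfl⟩ := Submodule.mem_span_singleton.1 hz
    have hgy : g y = 0 := hgW hy
    have ht : t = 0 := by simpa [hgy, hgv] using hgx
    subst ht
    exact hf _ hxP (by simpa using hy))
  have hgw : g w = 0 := hgW hwW
  refine hv (hmax (y := W ⊔ ℚ_[p] ∙ v)
    ⟨Submodule.mem_sup_left hwW, f + c • g, ?_, by simpa [hgw] using hfw⟩ le_sup_left
    (Submodule.mem_sup_right (Submodule.mem_span_singleton_self v)))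
  intro x hx hxW
  simpa using hc x ⟨hx, hxW⟩

/-- A bounded set has a finite subset that generates a `ℤ_p`-submodule containing it. -/
lemma exists_finset_generators {X : Type*} [NormedAddCommGroup X] [NormedSpace ℚ_[p] X]
    [FiniteDimensional ℚ_[p] X] {C : Set X} (hC : Bornology.IsBounded C) :
    ∃ F : Finset X, (F : Set X) ⊆ C ∧
      ∀ P : Set X, IsZpSubmodule p P → (F : Set X) ⊆ P → C ⊆ P := by
  let _ : Module ℤ_[p] X := Module.compHom X (algebraMap ℤ_[p] ℚ_[p])
  have hsmul (c : ℤ_[p]) (x : X) : c • x = (c : ℚ_[p]) • x := rfl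
  let e := (Module.finBasis ℚ_[p] X).equivFunL
  obtain ⟨r, hr⟩ := (e.lipschitz.isBounded_image hC).exists_norm_le
  obtain ⟨t, ht0, ht⟩ : ∃ t : ℚ_[p], t ≠ 0 ∧ ‖t‖ * r ≤ 1 := by
    obtain ⟨t, ht0, ht⟩ := NormedField.exists_norm_lt ℚ_[p]
      (r := (|r| + 1)⁻¹) (by positivity)
    refine ⟨t, norm_pos_iff.1 ht0, ?_⟩
    calc ‖t‖ * r ≤ ‖t‖ * (|r| + 1) := by
          gcongr
          linarith [le_abs_self r]
      _ ≤ (|r| + 1)⁻¹ * (|r| + 1) := by gcongr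
      _ = 1 := inv_mul_cancel₀ (by positivity)
  let N : Submodule ℤ_[p] X :=
    { carrier := {x | ∀ i, ‖t * e x i‖ ≤ 1}
      zero_mem' := by simp
      add_mem' := fun {a b} ha hb i => by
        rw [map_add, Pi.add_apply, mul_add]
        exact (Padic.nonarchimedean _ _).trans (max_le (ha i) (hb i))
      smul_mem' := fun c x hx i => by
        rw [hsmul, map_smul, Pi.smul_apply, smul_eq_mul, mul_left_comm, norm_mul]
        exact mul_le_one₀ c.norm_le_one (norm_nonneg _) (hx i) }
  have hCN : C ⊆ N := fun x hx i => by
    rw [norm_mul]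
    refine le_trans ?_ ht
    gcongr
    exact (norm_le_pi_norm (e x) i).trans (hr _ ⟨x, hx, rfl⟩)
  let φ : N →ₗ[ℤ_[p]] (Fin (Module.finrank ℚ_[p] X) → ℤ_[p]) :=
    { toFun := fun x i => ⟨t * e x.1 i, x.2 i⟩
      map_add' := fun x y => by
        ext i
        exact (congrArg (t * · i) (map_add e x.1 y.1)).trans (mul_add _ _ _)
      map_smul' := fun c x => by
        ext i
        exact (congrArg (t * · i) (map_smul e (c : ℚ_[p]) x.1)).trans (mul_left_comm _ _ _) }
  have hφ : Function.Injective φ := fun x y hxy => by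
    apply Subtype.ext
    apply e.injective
    ext i
    have := congrArg Subtype.val (congrFun hxy i)
    exact mul_left_cancel₀ ht0 this
  have hN : IsNoetherian ℤ_[p] N := isNoetherian_of_injective φ hφ
  have hfg := isNoetherian_submodule.1 hN (Submodule.span ℤ_[p] C) (Submodule.span_le.2 hCN)
  obtain ⟨F, hFC, hF⟩ := (Submodule.fg_span_iff_fg_span_finset_subset C).1 hfg
  refine ⟨F, hFC, fun P hP hFP => ?_⟩
  let P' : Submodule ℤ_[p] X :=
    { carrier := P
      zero_mem' := hP.1
      add_mem' := fun {a b} ha hb => hP.2.1 a ha b hb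
      smul_mem' := fun c x hx => hP.2.2 c c.norm_le_one x hx }
  have : Submodule.span ℤ_[p] C ≤ P' := hF ▸ Submodule.span_le.2 hFP
  exact fun x hx => this (Submodule.subset_span hx)

end ZpSubmodules

section SymplecticForms

variable {p : ℕ} [Fact p.Prime]

lemma Bform_eq_dotProduct {n : ℕ} (x y : SpV p n) :
    Bform p n x y = x.1 ⬝ᵥ y.2 - x.2 ⬝ᵥ y.1 := by
  simp [Bform, dotProduct, Finset.sum_sub_distrib]

lemma Bform_add_left {n : ℕ} (x x' y : SpV p n) :
    Bform p n (x + x') y = Bform p n x y + Bform p n x' y := by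
  simp only [Bform_eq_dotProduct, Prod.fst_add, Prod.snd_add, add_dotProduct]
  ring

lemma Bform_smul_left {n : ℕ} (c : ℚ_[p]) (x y : SpV p n) :
    Bform p n (c • x) y = c * Bform p n x y := by
  simp only [Bform_eq_dotProduct, Prod.smul_fst, Prod.smul_snd, smul_dotProduct, smul_eq_mul]
  ring

lemma Bform_swap {n : ℕ} (x y : SpV p n) : Bform p n x y = -Bform p n y x := by
  simp only [Bform_eq_dotProduct, dotProduct_comm x.1, dotProduct_comm x.2]
  ring

lemma Bform_add_right {n : ℕ} (x y y' : SpV p n) :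
    Bform p n x (y + y') = Bform p n x y + Bform p n x y' := by
  simp only [Bform_swap x, Bform_add_left]
  ring

lemma Bform_smul_right {n : ℕ} (c : ℚ_[p]) (x y : SpV p n) :
    Bform p n x (c • y) = c * Bform p n x y := by
  simp only [Bform_swap x, Bform_smul_left]
  ring

@[simp] lemma Bform_zero_left {n : ℕ} (y : SpV p n) : Bform p n 0 y = 0 := by
  simp [Bform]

@[simp] lemma Bform_zero_right {n : ℕ} (x : SpV p n) : Bform p n x 0 = 0 := by
  simp [Bform]

lemma norm_Bform_le {n : ℕ} (x y : SpV p n) : ‖Bform p n x y‖ ≤ ‖x‖ * ‖y‖ := by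
  have hx1 (s) : ‖x.1 s‖ ≤ ‖x‖ := (norm_le_pi_norm x.1 s).trans (norm_fst_le x)
  have hx2 (s) : ‖x.2 s‖ ≤ ‖x‖ := (norm_le_pi_norm x.2 s).trans (norm_snd_le x)
  have hy1 (s) : ‖y.1 s‖ ≤ ‖y‖ := (norm_le_pi_norm y.1 s).trans (norm_fst_le y)
  have hy2 (s) : ‖y.2 s‖ ≤ ‖y‖ := (norm_le_pi_norm y.2 s).trans (norm_snd_le y)
  refine IsUltrametricDist.norm_sum_le_of_forall_le_of_nonneg (by positivity) fun s _ => ?_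
  rw [sub_eq_add_neg]
  refine (Padic.nonarchimedean _ _).trans (max_le ?_ ?_)
  · rw [norm_mul]
    exact mul_le_mul (hx1 s) (hy2 s) (norm_nonneg _) (norm_nonneg _)
  · rw [norm_neg, norm_mul]
    exact mul_le_mul (hx2 s) (hy1 s) (norm_nonneg _) (norm_nonneg _)

/-- Every functional on a coordinate space is the dot product with a vector. -/
lemma exists_dotProduct_eq {ι : Type*} [Fintype ι] (f : (ι → ℚ_[p]) →ₗ[ℚ_[p]] ℚ_[p]) :
    ∃ a : ι → ℚ_[p], ∀ x, f x = a ⬝ᵥ x := by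
  classical
  exact ⟨(dotProductEquiv ℚ_[p] ι).symm f, fun x =>
    (LinearMap.congr_fun ((dotProductEquiv ℚ_[p] ι).apply_symm_apply f) x).symm⟩

/-- The pairing given by the difference of dot products is perfect. -/
lemma exists_dotProduct_sub_eq {ι : Type*} [Fintype ι]
    (f : (ι → ℚ_[p]) × (ι → ℚ_[p]) →ₗ[ℚ_[p]] ℚ_[p]) :
    ∃ h : (ι → ℚ_[p]) × (ι → ℚ_[p]), ∀ v, f v = h.1 ⬝ᵥ v.2 - h.2 ⬝ᵥ v.1 := by
  obtain ⟨a, ha⟩ := exists_dotProduct_eq (f ∘ₗ LinearMap.inl ℚ_[p] _ _)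
  obtain ⟨b, hb⟩ := exists_dotProduct_eq (f ∘ₗ LinearMap.inr ℚ_[p] _ _)
  refine ⟨(b, -a), fun v => ?_⟩
  have hv : f v = f (v.1, 0) + f (0, v.2) := by
    rw [← map_add]
    simp
  rw [hv, show f (v.1, 0) = a ⬝ᵥ v.1 from ha v.1, show f (0, v.2) = b ⬝ᵥ v.2 from hb v.2]
  simp [add_comm]

lemma exists_Bform_eq {n : ℕ} (f : SpV p n →ₗ[ℚ_[p]] ℚ_[p]) :
    ∃ h, ∀ v, f v = Bform p n h v := by
  simpa only [Bform_eq_dotProduct] using exists_dotProduct_sub_eq f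

lemma exists_Bminus_eq {n : ℕ} (f : SpV p n × SpV p n →ₗ[ℚ_[p]] ℚ_[p]) :
    ∃ h, ∀ v, f v = Bminus p n v h := by
  obtain ⟨a, ha⟩ := exists_Bform_eq (f ∘ₗ LinearMap.inl ℚ_[p] _ _)
  obtain ⟨b, hb⟩ := exists_Bform_eq (f ∘ₗ LinearMap.inr ℚ_[p] _ _)
  refine ⟨((-1 : ℚ_[p]) • a, b), fun v => ?_⟩
  have hv : f v = f (v.1, 0) + f (0, v.2) := by
    rw [← map_add]
    simp
  rw [hv, show f (v.1, 0) = Bform p n a v.1 from ha v.1,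
    show f (0, v.2) = Bform p n b v.2 from hb v.2]
  rw [Bminus, Bform_smul_right, Bform_swap v.1, Bform_swap v.2]
  ring

lemma isZpSubmodule_dualMod_Bform {n : ℕ} (P : Set (SpV p n)) :
    IsZpSubmodule p (dualMod p (Bform p n) P) := by
  refine ⟨fun v _ => by simp, fun x hx y hy v hv => ?_, fun c hc x hx v hv => ?_⟩
  · rw [Bform_add_right]
    exact (Padic.nonarchimedean _ _).trans (max_le (hx v hv) (hy v hv))
  · rw [Bform_smul_right, norm_mul]
    exact mul_le_one₀ hc (norm_nonneg _) (hx v hv)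

lemma isZpSubmodule_norm_Bminus_le_one {n : ℕ} (y : SpV p n × SpV p n) :
    IsZpSubmodule p {z | ‖Bminus p n y z‖ ≤ 1} := by
  refine ⟨by simp [Bminus], fun z hz w hw => ?_, fun c hc z hz => ?_⟩
  · have : Bminus p n y (z + w) = Bminus p n y z + Bminus p n y w := by
      simp only [Bminus, Prod.fst_add, Prod.snd_add, Bform_add_right]
      ring
    rw [Set.mem_ofPred_eq, this]
    exact (Padic.nonarchimedean _ _).trans (max_le hz hw)
  · have : Bminus p n y (c • z) = c * Bminus p n y z := by
      simp only [Bminus, Prod.smul_fst, Prod.smul_snd, Bform_smul_right]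
      ring
    rw [Set.mem_ofPred_eq, this, norm_mul]
    exact mul_le_one₀ hc (norm_nonneg _) hz

/-- The double dual of a `ℤ_p`-submodule is contained in it. -/
lemma mem_of_forall_dualMod_Bform {n : ℕ} {P : Set (SpV p n)} (hP : IsZpSubmodule p P)
    {v : SpV p n} (hv : ∀ h ∈ dualMod p (Bform p n) P, ‖Bform p n v h‖ ≤ 1) : v ∈ P := by
  by_contra hvP
  obtain ⟨f, hfP, hfv⟩ := exists_functional_of_notMem hP hvP
  obtain ⟨h, hh⟩ := exists_Bform_eq f
  refine absurd (hv h fun x hx => ?_) (not_le.2 ?_)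
  · rw [Bform_swap, norm_neg, ← hh]
    exact hfP x hx
  · rwa [Bform_swap, norm_neg, ← hh]

lemma mem_of_forall_dualMod_Bminus {n : ℕ} {P : Set (SpV p n × SpV p n)}
    (hP : IsZpSubmodule p P) {v : SpV p n × SpV p n}
    (hv : ∀ h ∈ dualMod p (Bminus p n) P, ‖Bminus p n v h‖ ≤ 1) : v ∈ P := by
  by_contra hvP
  obtain ⟨f, hfP, hfv⟩ := exists_functional_of_notMem hP hvP
  obtain ⟨h, hh⟩ := exists_Bminus_eq f
  exact absurd (hv h fun x hx => hh x ▸ hfP x hx) (not_le.2 (hh v ▸ hfv))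

lemma norm_le_inv_of_norm_Bform_le_one {n : ℕ} {c : ℚ_[p]} (hc : c ≠ 0) {y : SpV p n}
    (hy : ∀ x : SpV p n, ‖x‖ ≤ ‖c‖ → ‖Bform p n x y‖ ≤ 1) : ‖y‖ ≤ ‖c‖⁻¹ := by
  have hc' : 0 < ‖c‖ := norm_pos_iff.2 hc
  refine max_le ((pi_norm_le_iff_of_nonneg (by positivity)).2 fun i => ?_)
    ((pi_norm_le_iff_of_nonneg (by positivity)).2 fun i => ?_)
  · have := hy (0, Pi.single i c) (by simp [Prod.norm_def, Pi.norm_single])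
    rw [Bform_eq_dotProduct] at this
    simp only [zero_dotProduct, single_dotProduct, zero_sub, norm_neg, norm_mul] at this
    rwa [← one_div, le_div_iff₀' hc']
  · have := hy (Pi.single i c, 0) (by simp [Prod.norm_def, Pi.norm_single])
    rw [Bform_eq_dotProduct] at this
    simp only [zero_dotProduct, single_dotProduct, sub_zero, norm_mul] at this
    rwa [← one_div, le_div_iff₀' hc']

lemma isBounded_dualMod_Bminus {n : ℕ} {P : Set (SpV p n × SpV p n)} {ε : ℝ} (hε : 0 < ε)
    (hP : ∀ x, ‖x‖ ≤ ε → x ∈ P) : Bornology.IsBounded (dualMod p (Bminus p n) P) := by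
  obtain ⟨c, hc0, hc⟩ := NormedField.exists_norm_lt ℚ_[p] hε
  refine isBounded_iff_forall_norm_le.2 ⟨‖c‖⁻¹, fun z hz => max_le ?_ ?_⟩
  · refine norm_le_inv_of_norm_Bform_le_one (norm_pos_iff.1 hc0) fun x hx => ?_
    have := hz (x, 0) (hP _ (by simpa [Prod.norm_def] using hx.trans hc.le))
    simpa [Bminus] using this
  · refine norm_le_inv_of_norm_Bform_le_one (norm_pos_iff.1 hc0) fun x hx => ?_
    have := hz (0, x) (hP _ (by simpa [Prod.norm_def] using hx.trans hc.le))
    simpa [Bminus] using this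

instance Prod.instIsUltrametricDist {X Y : Type*} [PseudoMetricSpace X] [PseudoMetricSpace Y]
    [IsUltrametricDist X] [IsUltrametricDist Y] : IsUltrametricDist (X × Y) where
  dist_triangle_max x y z := max_le
    ((dist_triangle_max x.1 y.1 z.1).trans (max_le_max (le_max_left _ _) (le_max_left _ _)))
    ((dist_triangle_max x.2 y.2 z.2).trans (max_le_max (le_max_right _ _) (le_max_right _ _)))

lemma isZpSubmodule_neighborhood {X : Type*} [NormedAddCommGroup X] [NormedSpace ℚ_[p] X]
    [IsUltrametricDist X] {P : Set X} (hP : IsZpSubmodule p P) {ε : ℝ} (hε : 0 ≤ ε) :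
    IsZpSubmodule p {x | ∃ r ∈ P, ‖x - r‖ ≤ ε} := by
  refine ⟨⟨0, hP.1, by simpa⟩, ?_, ?_⟩
  · rintro x ⟨r, hr, hxr⟩ y ⟨s, hs, hys⟩
    refine ⟨r + s, hP.2.1 r hr s hs, ?_⟩
    rw [add_sub_add_comm]
    exact (IsUltrametricDist.norm_add_le_max _ _).trans (max_le hxr hys)
  · rintro c hc x ⟨r, hr, hxr⟩
    refine ⟨c • r, hP.2.2 c hc r hr, ?_⟩
    rw [← smul_sub, norm_smul]
    exact (mul_le_of_le_one_left (norm_nonneg _) hc).trans hxr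

/-- A functional on a `ℚ_p`-space that is bounded by `1` vanishes. -/
lemma eq_zero_of_forall_norm_le_one {X : Type*} [AddCommGroup X] [Module ℚ_[p] X]
    (f : X →ₗ[ℚ_[p]] ℚ_[p]) (hf : ∀ x, ‖f x‖ ≤ 1) (x : X) : f x = 0 := by
  by_contra h
  obtain ⟨t, ht⟩ := NormedField.exists_lt_norm ℚ_[p] ‖f x‖⁻¹
  have h1 := hf (t • x)
  rw [map_smul, smul_eq_mul, norm_mul] at h1
  have h2 : 0 < ‖f x‖ := norm_pos_iff.2 h
  have : 1 < ‖t‖ * ‖f x‖ := by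
    rwa [← inv_mul_cancel₀ h2.ne', mul_lt_mul_iff_left₀ h2]
  linarith

/-- If `P_j ↗ P`, then each vector of the dual of `P` eventually lies in the dual of `P_j`. -/
lemma ConvUp.eventually_mem_dualMod {n : ℕ} {Ps : ℕ → Set (SpV p n)} {P : Set (SpV p n)}
    (hPs : ConvUp Ps P) {h : SpV p n} (hh : h ∈ dualMod p (Bform p n) P) :
    ∀ᶠ j in Filter.atTop, h ∈ dualMod p (Bform p n) (Ps j) := by
  obtain ⟨J, hJ⟩ := hPs.2 (‖h‖ + 1)⁻¹ (by positivity)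
  filter_upwards [Filter.eventually_ge_atTop J] with j hj x hx
  obtain ⟨r, hr, hxr⟩ := hJ j hj x hx
  rw [← add_sub_cancel r x, Bform_add_left]
  refine (Padic.nonarchimedean _ _).trans (max_le (hh r hr) ((norm_Bform_le _ _).trans ?_))
  calc ‖x - r‖ * ‖h‖ ≤ (‖h‖ + 1)⁻¹ * (‖h‖ + 1) := by
        gcongr
        linarith
    _ = 1 := inv_mul_cancel₀ (by positivity)

lemma ConvUp.eventually_mem {X : Type*} [SeminormedAddCommGroup X] {Ps : ℕ → Set X} {P : Set X}
    (hPs : ConvUp Ps P) {h : X} (hh : h ∈ P) : ∀ᶠ j in Filter.atTop, h ∈ Ps j := by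
  obtain ⟨J, hJ⟩ := hPs.1 {h} (by simpa using hh) isCompact_singleton
  filter_upwards [Filter.eventually_ge_atTop J] with j hj
  exact hJ j hj rfl

end SymplecticForms

section CharacteristicFunction

variable {p α k m : ℕ} [Fact p.Prime]

lemma glue_add (u u' : Fin α → ℚ_[p]) (x x' : Fin k → Fin m → ℚ_[p]) :
    glue (u + u') (x + x') = glue u x + glue u' x' := by
  ext (i | i) <;> simp [glue]

lemma glue_smul (c : ℚ_[p]) (u : Fin α → ℚ_[p]) (x : Fin k → Fin m → ℚ_[p]) :
    glue (c • u) (c • x) = c • glue u x := by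
  ext (i | i) <;> simp [glue]

lemma glue_zero : glue (0 : Fin α → ℚ_[p]) (0 : Fin k → Fin m → ℚ_[p]) = 0 := by
  ext (i | i) <;> simp [glue]

lemma glue_inl_inr (w : BigIx α k m → ℚ_[p]) :
    glue (fun i => w (Sum.inl i)) (fun j s => w (Sum.inr (j, s))) = w := by
  ext (i | i) <;> simp [glue]

lemma eq_glue_neg_of_glue_eq_add {u : Fin α → ℚ_[p]} {x : Fin k → Fin m → ℚ_[p]}
    {a : BigIx α k m → ℚ_[p]} (h : glue u 0 = a + glue 0 x) : a = glue u (-x) := by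
  rw [eq_sub_of_add_eq h.symm, sub_eq_iff_eq_add, ← glue_add]
  simp

lemma glue_dotProduct_glue (u u' : Fin α → ℚ_[p]) (x x' : Fin k → Fin m → ℚ_[p]) :
    glue u x ⬝ᵥ glue u' x' = u ⬝ᵥ u' + ∑ s, ∑ j, x j s * x' j s := by
  simp only [dotProduct, Fintype.sum_sum_type, glue, Sum.elim_inl, Sum.elim_inr,
    Fintype.sum_prod_type]
  rw [Finset.sum_comm]

/-- The standard symplectic form on glued vectors splits over the blocks. -/
lemma glue_dotProduct_sub (u u' : SpV p α) (xp xm xp' xm' : Fin k → Fin m → ℚ_[p]) :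
    glue u.1 xp ⬝ᵥ glue u'.2 xm' - glue u.2 xm ⬝ᵥ glue u'.1 xp' =
      Bform p α u u' + ∑ s, Bform p k (tupleSlice xp xm s) (tupleSlice xp' xm' s) := by
  simp only [glue_dotProduct_glue]
  simp only [Bform, dotProduct, tupleSlice, Finset.sum_sub_distrib]
  ring

lemma isZpSubmodule_chiM (M : Matrix (BigIx α k m) (BigIx α k m) ℚ_[p]) {Q T : Set (SpV p k)}
    (hQ : IsZpSubmodule p Q) (hT : IsZpSubmodule p T) :
    IsZpSubmodule p (chiM p α k m M Q T) := by
  refine ⟨⟨0, 0, 0, 0, fun s => hQ.1, fun s => hT.1, ?_, ?_⟩, ?_, ?_⟩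
  · simp [glue_zero]
  · simp [glue_zero]
  · rintro z ⟨xp, xm, yp, ym, hx, hy, h1, h2⟩ z' ⟨xp', xm', yp', ym', hx', hy', h1', h2'⟩
    refine ⟨xp + xp', xm + xm', yp + yp', ym + ym',
      fun s => hQ.2.1 _ (hx s) _ (hx' s), fun s => hT.2.1 _ (hy s) _ (hy' s), ?_, ?_⟩
    · simp only [Prod.fst_add, Prod.snd_add, glue_add, Matrix.mulVec_add, h1, h1']
    · simp only [Prod.fst_add, Prod.snd_add, glue_add, Matrix.mulVec_add, h2, h2']
  · rintro c hc z ⟨xp, xm, yp, ym, hx, hy, h1, h2⟩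
    refine ⟨c • xp, c • xm, c • yp, c • ym,
      fun s => hQ.2.2 c hc _ (hx s), fun s => hT.2.2 c hc _ (hy s), ?_, ?_⟩
    · simp only [Prod.smul_fst, Prod.smul_snd, glue_smul, Matrix.mulVec_smul, h1]
    · simp only [Prod.smul_fst, Prod.smul_snd, glue_smul, Matrix.mulVec_smul, h2]

lemma dotProduct_transpose_mulVec {ι : Type*} [Fintype ι] (M : Matrix ι ι ℚ_[p])
    (a b : ι → ℚ_[p]) : a ⬝ᵥ M.transpose.mulVec b = M.mulVec a ⬝ᵥ b := by
  rw [Matrix.dotProduct_mulVec, Matrix.vecMul_transpose]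

/-- The characteristic function of the duals is contained in the dual of the characteristic
function. -/
lemma chiM_dualMod_subset (M : Matrix (BigIx α k m) (BigIx α k m) ℚ_[p]) (Q T : Set (SpV p k)) :
    chiM p α k m M (dualMod p (Bform p k) Q) (dualMod p (Bform p k) T) ⊆
      dualMod p (Bminus p α) (chiM p α k m M Q T) := by
  rintro d ⟨xp', xm', yp', ym', hx', hy', h1', h2'⟩ z ⟨xp, xm, yp, ym, hx, hy, h1, h2⟩
  have hu := glue_dotProduct_sub z.1 d.1 xp xm xp' xm'
  have hv := glue_dotProduct_sub z.2 d.2 yp ym yp' ym'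
  have heq : Bminus p α z d = ∑ s, Bform p k (tupleSlice yp ym s) (tupleSlice yp' ym' s) +
      -∑ s, Bform p k (tupleSlice xp xm s) (tupleSlice xp' xm' s) := by
    rw [h2', h2, dotProduct_transpose_mulVec, dotProduct_comm (M.transpose.mulVec _),
      dotProduct_transpose_mulVec, ← h1, ← h1', dotProduct_comm (glue d.2.1 yp')] at hu
    rw [Bminus]
    linear_combination hv - hu
  rw [heq]
  refine (Padic.nonarchimedean _ _).trans (max_le ?_ ?_)
  · exact IsUltrametricDist.norm_sum_le_of_forall_le_of_nonneg zero_le_one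
      fun s _ => hy' s _ (hy s)
  · rw [norm_neg]
    exact IsUltrametricDist.norm_sum_le_of_forall_le_of_nonneg zero_le_one
      fun s _ => hx' s _ (hx s)

/-- If the functional `x ↦ Σ_s B(e_s, x_s)` is bounded by `1` for `x ∈ Q^⊥⊥ ⊗ ℤ_p^m`, then
`e ∈ Q ⊗ ℤ_p^m`. -/
lemma tupleSlice_mem_of_forall {Q : Set (SpV p k)} (hQ : IsZpSubmodule p Q)
    {ep em : Fin k → Fin m → ℚ_[p]}
    (h : ∀ xp xm : Fin k → Fin m → ℚ_[p],
      (∀ s, tupleSlice xp xm s ∈ dualMod p (Bform p k) Q) →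
      ‖∑ s, Bform p k (tupleSlice ep em s) (tupleSlice xp xm s)‖ ≤ 1) (s : Fin m) :
    tupleSlice ep em s ∈ Q := by
  refine mem_of_forall_dualMod_Bform hQ fun v hv => ?_
  have hs (s' : Fin m) : tupleSlice (fun j s' => if s' = s then v.1 j else 0)
      (fun j s' => if s' = s then v.2 j else 0) s' = if s' = s then v else 0 := by
    by_cases hs' : s' = s
    · simp [tupleSlice, hs']
    · simp only [tupleSlice, hs', if_false]
      rfl
  have := h (fun j s' => if s' = s then v.1 j else 0) (fun j s' => if s' = s then v.2 j else 0)
    fun s' => by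
      rw [hs]
      split_ifs
      · exact hv
      · exact (isZpSubmodule_dualMod_Bform Q).1
  simp only [hs] at this
  rwa [Finset.sum_eq_single s (fun b _ hb => by simp [hb]) (by simp), if_pos rfl] at this

/-- The point of the graph of `M` and `Mᵗ` with parameters `a` and `b`, shifted by the tuples
`x` and `y`. -/
noncomputable def graphPoint (M : Matrix (BigIx α k m) (BigIx α k m) ℚ_[p]) (a b : BigIx α k m → ℚ_[p])
    (xp xm yp ym : Fin k → Fin m → ℚ_[p]) :
    ((BigIx α k m → ℚ_[p]) × (BigIx α k m → ℚ_[p])) ×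
      ((BigIx α k m → ℚ_[p]) × (BigIx α k m → ℚ_[p])) :=
  ((a + glue 0 xp, M.transpose.mulVec b + glue 0 xm), (M.mulVec a + glue 0 yp, b + glue 0 ym))

/-- The sum of the graph of `M` and `Mᵗ` and of `0 ⊕ (Q ⊗ ℤ_p^m) ⊕ (T ⊗ ℤ_p^m)`. -/
def thickGraph (M : Matrix (BigIx α k m) (BigIx α k m) ℚ_[p]) (Q T : Set (SpV p k)) :
    Set (((BigIx α k m → ℚ_[p]) × (BigIx α k m → ℚ_[p])) ×
      ((BigIx α k m → ℚ_[p]) × (BigIx α k m → ℚ_[p]))) :=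
  {w | ∃ a b xp xm yp ym, (∀ s, tupleSlice xp xm s ∈ Q) ∧ (∀ s, tupleSlice yp ym s ∈ T) ∧
    w = graphPoint M a b xp xm yp ym}

lemma isZpSubmodule_thickGraph (M : Matrix (BigIx α k m) (BigIx α k m) ℚ_[p])
    {Q T : Set (SpV p k)} (hQ : IsZpSubmodule p Q) (hT : IsZpSubmodule p T) :
    IsZpSubmodule p (thickGraph (α := α) M Q T) := by
  have hadd (x x' : Fin k → Fin m → ℚ_[p]) :
      glue (0 : Fin α → ℚ_[p]) (x + x') = glue 0 x + glue 0 x' := by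
    rw [← glue_add, add_zero]
  have hsmul (c : ℚ_[p]) (x : Fin k → Fin m → ℚ_[p]) :
      glue (0 : Fin α → ℚ_[p]) (c • x) = c • glue 0 x := by
    rw [← glue_smul, smul_zero]
  refine ⟨⟨0, 0, 0, 0, 0, 0, fun s => hQ.1, fun s => hT.1, ?_⟩, ?_, ?_⟩
  · simp only [graphPoint, glue_zero, Matrix.mulVec_zero, add_zero]
    rfl
  · rintro w ⟨a, b, xp, xm, yp, ym, hx, hy, rfl⟩ w' ⟨a', b', xp', xm', yp', ym', hx', hy', rfl⟩
    refine ⟨a + a', b + b', xp + xp', xm + xm', yp + yp', ym + ym',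
      fun s => hQ.2.1 _ (hx s) _ (hx' s), fun s => hT.2.1 _ (hy s) _ (hy' s), ?_⟩
    simp only [graphPoint, hadd, Matrix.mulVec_add, Prod.mk_add_mk, add_add_add_comm]
  · rintro c hc w ⟨a, b, xp, xm, yp, ym, hx, hy, rfl⟩
    refine ⟨c • a, c • b, c • xp, c • xm, c • yp, c • ym,
      fun s => hQ.2.2 c hc _ (hx s), fun s => hT.2.2 c hc _ (hy s), ?_⟩
    simp only [graphPoint, hsmul, Matrix.mulVec_smul, Prod.smul_mk, smul_add]

/-- The dual of the characteristic function is contained in the characteristic function of the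
duals. -/
lemma dualMod_chiM_subset (M : Matrix (BigIx α k m) (BigIx α k m) ℚ_[p]) {Q T : Set (SpV p k)}
    (hQ : IsZpSubmodule p Q) (hT : IsZpSubmodule p T) :
    dualMod p (Bminus p α) (chiM p α k m M Q T) ⊆
      chiM p α k m M (dualMod p (Bform p k) Q) (dualMod p (Bform p k) T) := by
  intro d hd
  have hQ' := isZpSubmodule_dualMod_Bform Q
  have hT' := isZpSubmodule_dualMod_Bform T
  have hP := isZpSubmodule_thickGraph M hQ' hT'
  by_cases hmem : ((glue d.1.1 0, glue d.1.2 0), (glue d.2.1 0, glue d.2.2 0)) ∈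
      thickGraph M (dualMod p (Bform p k) Q) (dualMod p (Bform p k) T)
  · obtain ⟨a, b, xp, xm, yp, ym, hx, hy, hw⟩ := hmem
    simp only [graphPoint, Prod.mk.injEq] at hw
    obtain ⟨⟨h1, h2⟩, h3, h4⟩ := hw
    have h1 := eq_glue_neg_of_glue_eq_add h1
    have h2 := eq_glue_neg_of_glue_eq_add h2
    have h3 := eq_glue_neg_of_glue_eq_add h3
    have h4 := eq_glue_neg_of_glue_eq_add h4
    have hneg : ‖(-1 : ℚ_[p])‖ ≤ 1 := by simp
    refine ⟨-xp, -xm, -yp, -ym, fun s => ?_, fun s => ?_, ?_, ?_⟩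
    · have := hQ'.2.2 (-1) hneg _ (hx s)
      rwa [neg_one_smul] at this
    · have := hT'.2.2 (-1) hneg _ (hy s)
      rwa [neg_one_smul] at this
    · rw [← h3, ← h1]
    · rw [← h2, ← h4]
  exfalso
  obtain ⟨f, hfP, hfd⟩ := exists_functional_of_notMem hP hmem
  obtain ⟨⟨e₁, e₂⟩, he⟩ := exists_dotProduct_sub_eq (f ∘ₗ LinearMap.inl ℚ_[p] _ _)
  obtain ⟨⟨e₃, e₄⟩, he'⟩ := exists_dotProduct_sub_eq (-f ∘ₗ LinearMap.inr ℚ_[p] _ _)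
  have hf (w₁ w₂ w₃ w₄ : BigIx α k m → ℚ_[p]) : f ((w₁, w₂), (w₃, w₄)) =
      (e₁ ⬝ᵥ w₂ - e₂ ⬝ᵥ w₁) - (e₃ ⬝ᵥ w₄ - e₄ ⬝ᵥ w₃) := by
    have h1 : f ((w₁, w₂), 0) = e₁ ⬝ᵥ w₂ - e₂ ⬝ᵥ w₁ := he (w₁, w₂)
    have h2 : -f (0, (w₃, w₄)) = e₃ ⬝ᵥ w₄ - e₄ ⬝ᵥ w₃ := he' (w₃, w₄)
    rw [← h1, ← h2, sub_neg_eq_add, ← map_add]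
    simp
  have hN (a b : BigIx α k m → ℚ_[p]) :
      f ((a, M.transpose.mulVec b), (M.mulVec a, b)) = 0 := by
    let L : (BigIx α k m → ℚ_[p]) × (BigIx α k m → ℚ_[p]) →ₗ[ℚ_[p]]
        ((BigIx α k m → ℚ_[p]) × (BigIx α k m → ℚ_[p])) ×
          ((BigIx α k m → ℚ_[p]) × (BigIx α k m → ℚ_[p])) :=
      { toFun := fun w => ((w.1, M.transpose.mulVec w.2), (M.mulVec w.1, w.2))
        map_add' := fun w w' => by simp [Matrix.mulVec_add]
        map_smul' := fun c w => by simp [Matrix.mulVec_smul] }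
    refine eq_zero_of_forall_norm_le_one (f ∘ₗ L) (fun w => hfP _ ?_) (a, b)
    refine ⟨w.1, w.2, 0, 0, 0, 0, fun s => hQ'.1, fun s => hT'.1, ?_⟩
    simp [graphPoint, glue_zero, L]
  have he3 : e₃ = M.mulVec e₁ := by
    refine dotProduct_eq _ _ fun b => ?_
    have := hN 0 b
    rw [hf, dotProduct_transpose_mulVec] at this
    simp only [Matrix.mulVec_zero, dotProduct_zero, sub_zero] at this
    exact (sub_eq_zero.1 this).symm
  have he2 : e₂ = M.transpose.mulVec e₄ := by
    refine dotProduct_eq _ _ fun a => ?_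
    have := hN a 0
    rw [hf] at this
    simp only [Matrix.mulVec_zero, dotProduct_zero, zero_sub, sub_neg_eq_add] at this
    rw [dotProduct_comm (M.transpose.mulVec e₄), dotProduct_transpose_mulVec,
      dotProduct_comm (M.mulVec a)]
    linear_combination -this
  have hform (u u' : BigIx α k m → ℚ_[p]) (v : SpV p α) (xp xm : Fin k → Fin m → ℚ_[p]) :
      u ⬝ᵥ glue v.2 xm - u' ⬝ᵥ glue v.1 xp =
        Bform p α (fun i => u (Sum.inl i), fun i => u' (Sum.inl i)) v +
        ∑ s, Bform p k (tupleSlice (fun j s => u (Sum.inr (j, s)))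
          (fun j s => u' (Sum.inr (j, s))) s) (tupleSlice xp xm s) := by
    rw [← glue_dotProduct_sub, glue_inl_inr, glue_inl_inr]
  have hz : ((fun i => e₁ (Sum.inl i), fun i => e₂ (Sum.inl i)),
      (fun i => e₃ (Sum.inl i), fun i => e₄ (Sum.inl i))) ∈ chiM p α k m M Q T := by
    refine ⟨fun j s => e₁ (Sum.inr (j, s)), fun j s => e₂ (Sum.inr (j, s)),
      fun j s => e₃ (Sum.inr (j, s)), fun j s => e₄ (Sum.inr (j, s)),
      tupleSlice_mem_of_forall hQ fun xp xm hx => ?_,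
      tupleSlice_mem_of_forall hT fun yp ym hy => ?_, ?_, ?_⟩
    · have := hfP _ ⟨0, 0, xp, xm, 0, 0, hx, fun s => hT'.1, rfl⟩
      have h0 := hform e₁ e₂ 0 xp xm
      simp only [Prod.fst_zero, Prod.snd_zero, Bform_zero_right, zero_add] at h0
      simpa [graphPoint, glue_zero, hf, h0] using this
    · have := hfP _ ⟨0, 0, 0, 0, yp, ym, fun s => hQ'.1, hy, rfl⟩
      have h0 := hform e₃ e₄ 0 yp ym
      simp only [Prod.fst_zero, Prod.snd_zero, Bform_zero_right, zero_add] at h0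
      simp only [graphPoint, glue_zero, hf, Matrix.mulVec_zero, zero_add, dotProduct_zero, sub_zero,
        zero_sub, norm_neg, h0] at this
      exact this
    · simpa only [glue_inl_inr] using he3
    · simpa only [glue_inl_inr] using he2
  refine absurd (hd _ hz) (not_le.2 ?_)
  rw [hf] at hfd
  have h1 := hform e₁ e₂ d.1 0 0
  have h2 := hform e₃ e₄ d.2 0 0
  have hslice (s : Fin m) : tupleSlice (0 : Fin k → Fin m → ℚ_[p]) 0 s = 0 := rfl
  simp only [hslice, Bform_zero_right, Finset.sum_const_zero, add_zero] at h1 h2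
  rwa [h1, h2] at hfd

/-- If every element of `Q` eventually lies in `Q_j`, and likewise for `T`, then every element
of `χ_g(Q, T)` eventually lies in `χ_g(Q_j, T_j)`. -/
lemma eventually_mem_chiM (M : Matrix (BigIx α k m) (BigIx α k m) ℚ_[p])
    {Qs Ts : ℕ → Set (SpV p k)} {Q T : Set (SpV p k)}
    (hQ : ∀ h ∈ Q, ∀ᶠ j in Filter.atTop, h ∈ Qs j)
    (hT : ∀ h ∈ T, ∀ᶠ j in Filter.atTop, h ∈ Ts j)
    {z : SpV p α × SpV p α} (hz : z ∈ chiM p α k m M Q T) :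
    ∀ᶠ j in Filter.atTop, z ∈ chiM p α k m M (Qs j) (Ts j) := by
  obtain ⟨xp, xm, yp, ym, hx, hy, h1, h2⟩ := hz
  filter_upwards [Filter.eventually_all.2 fun s => hQ _ (hx s),
    Filter.eventually_all.2 fun s => hT _ (hy s)] with j hxj hyj
  exact ⟨xp, xm, yp, ym, hxj, hyj, h1, h2⟩

end CharacteristicFunction

/-- **Continuity of the characteristic function:** if `Q_j, Q, T_j, T` are almost self-dual
`ℤ_p`-submodules of `H` with `Q_j ↗ Q` and `T_j ↗ T`, then for every `g ∈ GL(α + km, ℚ_p)`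
one has `χ_g(Q_j, T_j) ↗ χ_g(Q, T)` as submodules of `V ⊕ V`. -/
theorem chi_continuity (p : ℕ) [Fact p.Prime] (α k m : ℕ) (hk : 1 ≤ k) (hm : 1 ≤ m)
    (M : Matrix (BigIx α k m) (BigIx α k m) ℚ_[p]) (hM : IsUnit M)
    (Qs Ts : ℕ → Set (SpV p k)) (Q T : Set (SpV p k))
    (hQsmod : ∀ j, IsZpSubmodule p (Qs j)) (hTsmod : ∀ j, IsZpSubmodule p (Ts j))
    (hQmod : IsZpSubmodule p Q) (hTmod : IsZpSubmodule p T)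
    (hQs : ∀ j, IsAlmostSelfDual p (Bform p k) (Qs j))
    (hTs : ∀ j, IsAlmostSelfDual p (Bform p k) (Ts j))
    (hQ : IsAlmostSelfDual p (Bform p k) Q) (hT : IsAlmostSelfDual p (Bform p k) T)
    (hQconv : ConvUp Qs Q) (hTconv : ConvUp Ts T) :
    ConvUp (fun j => chiM p α k m M (Qs j) (Ts j)) (chiM p α k m M Q T) := by
  refine ⟨fun S hS hSc => ?_, fun ε hε => ?_⟩
  · obtain ⟨F, hFS, hF⟩ := exists_finset_generators (p := p) hSc.isBounded
    have hev : ∀ᶠ j in Filter.atTop, ∀ z ∈ F, z ∈ chiM p α k m M (Qs j) (Ts j) :=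
      (Filter.eventually_all_finset F).2 fun z hz => eventually_mem_chiM M
        (fun _ => hQconv.eventually_mem) (fun _ => hTconv.eventually_mem) (hS (hFS hz))
    obtain ⟨J, hJ⟩ := Filter.eventually_atTop.1 hev
    exact ⟨J, fun j hj => hF _ (isZpSubmodule_chiM M (hQsmod j) (hTsmod j)) (hJ j hj)⟩
  · have hχ := isZpSubmodule_chiM M hQmod hTmod
    obtain ⟨F, hFD, hF⟩ := exists_finset_generators (p := p) (isBounded_dualMod_Bminus hε
      (P := {x | ∃ r ∈ chiM p α k m M Q T, ‖x - r‖ ≤ ε}) fun x hx => ⟨0, hχ.1, by simpa⟩)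
    have hev : ∀ᶠ j in Filter.atTop, ∀ z ∈ F, z ∈ chiM p α k m M
        (dualMod p (Bform p k) (Qs j)) (dualMod p (Bform p k) (Ts j)) :=
      (Filter.eventually_all_finset F).2 fun z hz => eventually_mem_chiM M
        (fun _ => hQconv.eventually_mem_dualMod) (fun _ => hTconv.eventually_mem_dualMod)
        (dualMod_chiM_subset M hQmod hTmod fun x hx =>
          hFD hz x ⟨x, hx, by simpa using hε.le⟩)
    obtain ⟨J, hJ⟩ := Filter.eventually_atTop.1 hev
    refine ⟨J, fun j hj x hx => ?_⟩
    exact mem_of_forall_dualMod_Bminus (isZpSubmodule_neighborhood hχ hε.le)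
      (hF _ (isZpSubmodule_norm_Bminus_le_one x) fun z hz =>
        chiM_dualMod_subset M _ _ (hJ j hj z hz) x hx)
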